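/- Let S be a term graph and p a position in S. If S ▷_p^ℓ T (an ℓ-fold unfolding above p), then ℓ ≤ |p| and |T| ≤ |S| + |p|, where |p| is the length of the position p. -/

import Mathlib

namespace TermGraphs

/-- First-order terms over a signature `F` and variables `V`. -/
inductive Tm (F V : Type) : Type
  | var : V → Tm F V
  | app : F → List (Tm F V) → Tm F V

/-- A (pre-)graph over labels `L`: a finite set of nodes (drawn from `ℕ`),
a successor map assigning each node an ordered sequence of nodes,
a labelling, and a designated root node. -/
structure PreGraph (L : Type) where
  nodes : Finset ℕ
  suc : ℕ → List ℕ
  lab : ℕ → L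
  root : ℕ

variable {F V L : Type}

/-- The edge relation of a graph: `u → v` iff `v` occurs in `suc u`. -/
def Edge (G : PreGraph L) (u v : ℕ) : Prop := u ∈ G.nodes ∧ v ∈ G.suc u

/-- `v` is reachable from `u` in `G`. -/
def Reach (G : PreGraph L) : ℕ → ℕ → Prop := Relation.ReflTransGen (Edge G)

/-- `ReachesP G u p v`: starting in `u` and following the position `p`
(a sequence of argument indices) one reaches the node `v`. -/
inductive ReachesP (G : PreGraph L) : ℕ → List ℕ → ℕ → Prop
  | nil (u : ℕ) : ReachesP G u [] u
  | cons {u v w : ℕ} {i : ℕ} {p : List ℕ} :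
      u ∈ G.nodes → (G.suc u)[i]? = some v → ReachesP G v p w →
      ReachesP G u (i :: p) w

/-- `p` is a position of the node `u` in `G`, i.e. `p ∈ Pos_G(u)`. -/
def IsPos (G : PreGraph L) (u : ℕ) (p : List ℕ) : Prop := ReachesP G G.root p u

/-- A node is unshared if its set of positions is a singleton. -/
def Unshared (G : PreGraph L) (u : ℕ) : Prop := ∃! p, IsPos G u p

/-- A node `u` is strictly below the position `p` if `p` is a proper prefix of
some position of `u`. -/
def StrictlyBelow (G : PreGraph L) (p : List ℕ) (u : ℕ) : Prop :=
  ∃ q, IsPos G u q ∧ p <+: q ∧ p ≠ q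

open Classical in
/-- `S↾u`, the subgraph of `S` reachable from the node `u`. -/
noncomputable def subgraph (G : PreGraph L) (u : ℕ) : PreGraph L where
  nodes := G.nodes.filter fun v => Reach G u v
  suc := G.suc
  lab := G.lab
  root := u

/-- The union `G ∪ H` of two graphs (for properly sharing graphs this
is symmetric on the common nodes). -/
def gUnion (G H : PreGraph L) : PreGraph L where
  nodes := G.nodes ∪ H.nodes
  suc := fun u => if u ∈ G.nodes then G.suc u else H.suc u
  lab := fun u => if u ∈ G.nodes then G.lab u else H.lab u
  root := G.root

/-- Two graphs are properly sharing if every common node carries the same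
label and the same successor sequence in both. -/
def ProperlySharing (G H : PreGraph L) : Prop :=
  ∀ u, u ∈ G.nodes → u ∈ H.nodes → G.lab u = H.lab u ∧ G.suc u = H.suc u

/-- The redirection `G[u ≫ v]`: the node `u` is removed (and `v` added), and
`u` is replaced by `v` in all successor sequences. -/
def redirect (G : PreGraph L) (u v : ℕ) : PreGraph L where
  nodes := insert v (G.nodes.erase u)
  suc := fun w => (G.suc w).map fun x => if x = u then v else x
  lab := G.lab
  root := if G.root = u then v else G.root

/-- The replacement `G[u ← H]`: the subgraph of `G[u ≫ root(H)] ∪ H` reachable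
from `root(H)` if `u = root(G)`, and from `root(G)` otherwise. -/
noncomputable def replaceAt (G : PreGraph L) (u : ℕ) (H : PreGraph L) : PreGraph L :=
  subgraph (gUnion H (redirect G u H.root)) (if u = G.root then H.root else G.root)

/-- A term graph over the signature `F` (with arities `ar`) and variables `V`:
an acyclic rooted graph whose nodes are labelled by function symbols or
variables, such that a node labelled by `f` has `ar f` successors, a node
labelled by a variable has no successors, and variable nodes are shared. -/
structure IsTermGraph (ar : F → ℕ) (G : PreGraph (F ⊕ V)) : Prop where
  closed : ∀ u ∈ G.nodes, ∀ v ∈ G.suc u, v ∈ G.nodes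
  acyclic : ∀ u v : ℕ, Relation.TransGen (Edge G) u v → u ≠ v
  rootMem : G.root ∈ G.nodes
  rootReach : ∀ u ∈ G.nodes, Reach G G.root u
  funArity : ∀ u ∈ G.nodes, ∀ f : F, G.lab u = Sum.inl f → (G.suc u).length = ar f
  varSuc : ∀ u ∈ G.nodes, ∀ x : V, G.lab u = Sum.inr x → G.suc u = []
  varShared : ∀ u ∈ G.nodes, ∀ v ∈ G.nodes, ∀ x : V,
      G.lab u = Sum.inr x → G.lab v = Sum.inr x → u = v

/-- Fuelled computation of the term represented by (the subgraph at) a node.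
For a term graph, any fuel strictly exceeding the length of the longest
path suffices; acyclicity bounds path lengths by the number of nodes. -/
noncomputable def termAt [Inhabited V] (G : PreGraph (F ⊕ V)) : ℕ → ℕ → Tm F V
  | 0, _ => Tm.var default
  | fuel + 1, u =>
    match G.lab u with
    | Sum.inr x => Tm.var x
    | Sum.inl f => Tm.app f ((G.suc u).map fun v => termAt G fuel v)

/-- `term(G)`, the term represented by the term graph `G`. -/
noncomputable def termOf [Inhabited V] (G : PreGraph (F ⊕ V)) : Tm F V :=
  termAt G (G.nodes.card + 1) G.root

/-- Application of a substitution `σ : V → Tm F V` to a term. -/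
def substTm (σ : V → Tm F V) : Tm F V → Tm F V
  | Tm.var x => σ x
  | Tm.app f ts => Tm.app f (ts.attach.map fun t => substTm σ t.1)
decreasing_by
  have := List.sizeOf_lt_of_mem t.2
  simp only [Tm.app.sizeOf_spec]
  omega

/-- The variable `x` occurs in the term `t`. -/
inductive OccursIn (x : V) : Tm F V → Prop
  | var : OccursIn x (Tm.var x)
  | app {f : F} {ts : List (Tm F V)} {t : Tm F V} :
      t ∈ ts → OccursIn x t → OccursIn x (Tm.app f ts)

/-- A morphism `m : L → S` of term graphs: it maps nodes to nodes, root to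
root, and preserves labels and successor sequences at every node of `L`
labelled by a function symbol. -/
structure IsMorphism (L S : PreGraph (F ⊕ V)) (m : ℕ → ℕ) : Prop where
  maps : ∀ u ∈ L.nodes, m u ∈ S.nodes
  root : m L.root = S.root
  lab : ∀ u ∈ L.nodes, ∀ f : F, L.lab u = Sum.inl f → S.lab (m u) = Sum.inl f
  suc : ∀ u ∈ L.nodes, ∀ f : F, L.lab u = Sum.inl f → S.suc (m u) = (L.suc u).map m

/-- `S ≥_m T`: `m` is a morphism whose label and successor conditions hold at
*all* nodes of `S`, including variable nodes. -/
structure IsGeMorph (S T : PreGraph (F ⊕ V)) (m : ℕ → ℕ) : Prop where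
  maps : ∀ u ∈ S.nodes, m u ∈ T.nodes
  root : m S.root = T.root
  lab : ∀ u ∈ S.nodes, T.lab (m u) = S.lab u
  suc : ∀ u ∈ S.nodes, T.suc (m u) = (S.suc u).map m

open Classical in
/-- The substitution `σ_m` induced by a morphism `m : L → S`: a variable `x`
labelling the (unique) node `u` of `L` is mapped to `term(S↾m(u))`. -/
noncomputable def inducedSubst [Inhabited V] (L S : PreGraph (F ⊕ V)) (m : ℕ → ℕ) :
    V → Tm F V := fun x =>
  if h : ∃ u, u ∈ L.nodes ∧ L.lab u = Sum.inr x then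
    termOf (subgraph S (m h.choose))
  else Tm.var x

/-- `S ⊒_{u,v} T` (for nodes `u ≽ v` of `S`, taking `≻` to be the usual order
on `ℕ`): `S ≥_m T` for the morphism `m` with `m u = v` and `m w = w` for all
other nodes `w`. -/
def Collapse (S T : PreGraph (F ⊕ V)) (u v : ℕ) : Prop :=
  u ∈ S.nodes ∧ v ∈ S.nodes ∧ v ≤ u ∧
    IsGeMorph S T (fun w => if w = u then v else w)

/-- `S ⊐_{u,v} T`: `S ⊒_{u,v} T` with `u ≠ v`. -/
def CollapseS (S T : PreGraph (F ⊕ V)) (u v : ℕ) : Prop :=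
  Collapse S T u v ∧ u ≠ v

/-- The single-step folding relation `S ⊐ T`. -/
def Fold (S T : PreGraph (F ⊕ V)) : Prop := ∃ u v, CollapseS S T u v

/-- `S ⊐_p T`: `S` folds strictly below the position `p` to `T`. -/
def FoldBelow (p : List ℕ) (S T : PreGraph (F ⊕ V)) : Prop :=
  ∃ u v, CollapseS S T u v ∧ StrictlyBelow S p u ∧ StrictlyBelow S p v

/-- `S ▷_p T`: `S` unfolds above the position `p` to `T`, i.e. `T ⊐_{u,v} S`
for some node `u` of `T` that is unshared in `T` and whose unique position is
a prefix of `p`. -/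
def UnfoldAbove (p : List ℕ) (S T : PreGraph (F ⊕ V)) : Prop :=
  ∃ u v, CollapseS T S u v ∧ ∃ q, q <+: p ∧ (∀ q', IsPos T u q' ↔ q' = q)

/-- The relation `⊐` restricted to term graphs. -/
def FoldTG (ar : F → ℕ) (S T : PreGraph (F ⊕ V)) : Prop :=
  IsTermGraph ar S ∧ IsTermGraph ar T ∧ Fold S T

/-- The relation `⊐_p` restricted to term graphs. -/
def FoldBelowTG (ar : F → ℕ) (p : List ℕ) (S T : PreGraph (F ⊕ V)) : Prop :=
  IsTermGraph ar S ∧ IsTermGraph ar T ∧ FoldBelow p S T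

/-- The relation `▷_p` restricted to term graphs. -/
def UnfoldAboveTG (ar : F → ℕ) (p : List ℕ) (S T : PreGraph (F ⊕ V)) : Prop :=
  IsTermGraph ar S ∧ IsTermGraph ar T ∧ UnfoldAbove p S T

/-- `a →^! b` for an abstract relation `r`: `a r^* b` and `b` is `r`-minimal. -/
def NormTo {α : Type _} (r : α → α → Prop) (a b : α) : Prop :=
  Relation.ReflTransGen r a b ∧ ∀ c, ¬ r b c

/-- The `n`-fold composition of an abstract relation. -/
def Iter {α : Type _} (r : α → α → Prop) : ℕ → α → α → Prop
  | 0 => Eq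
  | n + 1 => fun a c => ∃ b, r a b ∧ Iter r n b c

/-- The node `u` of `G` is labelled by a variable. -/
def IsVarNode (G : PreGraph (F ⊕ V)) (u : ℕ) : Prop := ∃ x : V, G.lab u = Sum.inr x

/-- A graph rewrite rule `L → R`: `L` and `R` are properly sharing term
graphs, `root(L)` is not a variable node, every variable of `R` occurs in
`L`, and `root(L)` is not a node of `R`. -/
structure IsRule (ar : F → ℕ) (Lhs Rhs : PreGraph (F ⊕ V)) : Prop where
  lhs : IsTermGraph ar Lhs
  rhs : IsTermGraph ar Rhs
  sharing : ProperlySharing Lhs Rhs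
  rootNotVar : ¬ IsVarNode Lhs Lhs.root
  varsSub : ∀ x : V, (∃ u ∈ Rhs.nodes, Rhs.lab u = Sum.inr x) →
      (∃ u ∈ Lhs.nodes, Lhs.lab u = Sum.inr x)
  rootNotInRhs : Lhs.root ∉ Rhs.nodes

/-- `m(R)`: the graph obtained from `R` by replacing every node `v` in the
domain `dom` of the morphism `m` by `m v`; the replaced nodes keep the labels
and successor sequences they have in `S`. -/
def applyMorph (dom : Finset ℕ) (m : ℕ → ℕ) (S R : PreGraph (F ⊕ V)) :
    PreGraph (F ⊕ V) where
  nodes := R.nodes.image fun v => if v ∈ dom then m v else v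
  suc := fun w => if w ∈ S.nodes then S.suc w
                  else (R.suc w).map fun x => if x ∈ dom then m x else x
  lab := fun w => if w ∈ S.nodes then S.lab w else R.lab w
  root := if R.root ∈ dom then m R.root else R.root

/-- `φ` exhibits `G'` as an isomorphic copy of `G`. -/
structure GIsoOn (φ : ℕ → ℕ) (G G' : PreGraph (F ⊕ V)) : Prop where
  nodes : G'.nodes = G.nodes.image φ
  root : φ G.root = G'.root
  lab : ∀ u ∈ G.nodes, G'.lab (φ u) = G.lab u
  suc : ∀ u ∈ G.nodes, G'.suc (φ u) = (G.suc u).map φ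

/-- `L' → R'` is a renaming of the rule `L → R` with respect to `S`: an
isomorphic copy that is node-disjoint from `S`. -/
def IsRenaming (L R L' R' S : PreGraph (F ⊕ V)) : Prop :=
  ∃ φ : ℕ → ℕ, Set.InjOn φ ↑(L.nodes ∪ R.nodes) ∧
    GIsoOn φ L L' ∧ GIsoOn φ R R' ∧ Disjoint (L'.nodes ∪ R'.nodes) S.nodes

/-- `S ⇒_{G,u} T`: a graph rewrite step at the node `u`, using a renaming
`L' → R'` of some rule of `G`, a morphism `m : L' → S↾u`, and
`T = S[u ← m(R')]`. -/
def GStepAt (G : Set (PreGraph (F ⊕ V) × PreGraph (F ⊕ V))) (u : ℕ)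
    (S T : PreGraph (F ⊕ V)) : Prop :=
  ∃ LR ∈ G, ∃ L' R' : PreGraph (F ⊕ V), ∃ m : ℕ → ℕ,
    IsRenaming LR.1 LR.2 L' R' S ∧
    IsMorphism L' (subgraph S u) m ∧
    T = replaceAt S u (applyMorph L'.nodes m S R')

/-- `S ⇒_{G,p} T`: a graph rewrite step at the node corresponding to the
position `p`. -/
def GStepP (G : Set (PreGraph (F ⊕ V) × PreGraph (F ⊕ V))) (p : List ℕ)
    (S T : PreGraph (F ⊕ V)) : Prop :=
  ∃ u, IsPos S u p ∧ GStepAt G u S T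

/-- A term rewrite system: a finite set of rules `l → r` where `l` is not a
variable and every variable of `r` occurs in `l`. -/
def IsTRS (R : Set (Tm F V × Tm F V)) : Prop :=
  R.Finite ∧ ∀ lr ∈ R, (∀ x : V, lr.1 ≠ Tm.var x) ∧
    ∀ x : V, OccursIn x lr.2 → OccursIn x lr.1

/-- `s →_{R,p} t`: a rewrite step of the TRS `R` at position `p`. -/
inductive RewriteAt (R : Set (Tm F V × Tm F V)) : List ℕ → Tm F V → Tm F V → Prop
  | root {l r : Tm F V} (σ : V → Tm F V) :
      (l, r) ∈ R → RewriteAt R [] (substTm σ l) (substTm σ r)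
  | congr {i : ℕ} {p : List ℕ} {f : F} {ts : List (Tm F V)} {t t' : Tm F V} :
      ts[i]? = some t → RewriteAt R p t t' →
      RewriteAt R (i :: p) (Tm.app f ts) (Tm.app f (ts.set i t'))

/-- A graph is minimally sharing if every node is a variable node or unshared. -/
def MinimallySharing (G : PreGraph (F ⊕ V)) : Prop :=
  ∀ u ∈ G.nodes, IsVarNode G u ∨ Unshared G u

/-- A graph is maximally sharing if distinct nodes represent distinct terms. -/
def MaximallySharing [Inhabited V] (G : PreGraph (F ⊕ V)) : Prop :=
  ∀ u ∈ G.nodes, ∀ v ∈ G.nodes,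
    termOf (subgraph G u) = termOf (subgraph G v) → u = v

/-- `G ∈ Tree(s)`: `G` is a minimally sharing term graph representing `s`. -/
def InTree [Inhabited V] (ar : F → ℕ) (s : Tm F V) (G : PreGraph (F ⊕ V)) : Prop :=
  IsTermGraph ar G ∧ MinimallySharing G ∧ termOf G = s

/-- `G ∈ Shared(s)`: `G` is a maximally sharing term graph representing `s`. -/
def InShared [Inhabited V] (ar : F → ℕ) (s : Tm F V) (G : PreGraph (F ⊕ V)) : Prop :=
  IsTermGraph ar G ∧ MaximallySharing G ∧ termOf G = s

/-- `L → R` is a graph rewrite rule simulating the term rewrite rule `l → r`: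
`L ∈ Tree(l)`, `R ∈ Tree(r)` and the common nodes of `L` and `R` are exactly
the variable nodes of `R`. -/
def SimRule [Inhabited V] (ar : F → ℕ) (l r : Tm F V)
    (Lg Rg : PreGraph (F ⊕ V)) : Prop :=
  IsRule ar Lg Rg ∧ InTree ar l Lg ∧ InTree ar r Rg ∧
    ∀ w : ℕ, (w ∈ Lg.nodes ∧ w ∈ Rg.nodes) ↔ (w ∈ Rg.nodes ∧ IsVarNode Rg w)

/-- `G` is the simulating graph rewrite system `G(R)` of the TRS `R`. -/
def IsSimGRS [Inhabited V] (ar : F → ℕ) (R : Set (Tm F V × Tm F V))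
    (G : Set (PreGraph (F ⊕ V) × PreGraph (F ⊕ V))) : Prop :=
  (∀ lr ∈ R, ∃ LR ∈ G, SimRule ar lr.1 lr.2 LR.1 LR.2) ∧
  (∀ LR ∈ G, ∃ lr ∈ R, SimRule ar lr.1 lr.2 LR.1 LR.2)

/-- `S ⇒ˢ_{G,p} T`: `S ▷_p^! U`, `U ⊐_p^! V` and `V ⇒_{G,p} T` for some
term graphs `U`, `V`. -/
def SStepP (ar : F → ℕ) (G : Set (PreGraph (F ⊕ V) × PreGraph (F ⊕ V)))
    (p : List ℕ) (S T : PreGraph (F ⊕ V)) : Prop :=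
  ∃ U Vg : PreGraph (F ⊕ V),
    NormTo (UnfoldAboveTG ar p) S U ∧ NormTo (FoldBelowTG ar p) U Vg ∧
    GStepP G p Vg T

/-- `S ⇒ˢ_G T`: an `⇒ˢ`-step at some position. -/
def SStep (ar : F → ℕ) (G : Set (PreGraph (F ⊕ V) × PreGraph (F ⊕ V)))
    (S T : PreGraph (F ⊕ V)) : Prop :=
  ∃ p : List ℕ, SStepP ar G p S T

/-- `G` has a path of `n` edges. -/
def HasPathLen (G : PreGraph L) (n : ℕ) : Prop :=
  ∃ l : List ℕ, l.length = n + 1 ∧ l.Chain' (Edge G) ∧ ∀ x ∈ l, x ∈ G.nodes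

/-- The depth of `G`: the length of the longest path in `G`. -/
noncomputable def depth (G : PreGraph L) : ℕ := sSup {n | HasPathLen G n}

/-- Filling every hole of a context (a term over `F ∪ {□}`, the hole `□`
being represented by `none`) with the term `t`. -/
def fillAll (t : Tm F V) : Tm (Option F) V → Tm F V
  | Tm.var x => Tm.var x
  | Tm.app none _ => t
  | Tm.app (some f) ts => Tm.app f (ts.attach.map fun c => fillAll t c.1)
decreasing_by
  have := List.sizeOf_lt_of_mem c.2
  simp only [Tm.app.sizeOf_spec]
  omega

/-- Viewing a graph over `F ∪ V` as a graph over `(F ∪ {□}) ∪ V`. -/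
def relabel (G : PreGraph (F ⊕ V)) : PreGraph (Option F ⊕ V) where
  nodes := G.nodes
  suc := G.suc
  lab := fun u => Sum.map some id (G.lab u)
  root := G.root

/-- The one-node graph consisting of a hole node `h` labelled `□`. -/
def holeGraph (h : ℕ) : PreGraph (Option F ⊕ V) where
  nodes := {h}
  suc := fun _ => []
  lab := fun _ => Sum.inl none
  root := h

theorem ReachesP.reach {G : PreGraph L} {u v : ℕ} {p : List ℕ} (h : ReachesP G u p v) :
    Reach G u v := by
  induction h with
  | nil u => exact Relation.ReflTransGen.refl
  | cons hu hi _ ih => exact Relation.ReflTransGen.head ⟨hu, List.mem_of_getElem? hi⟩ ih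

theorem Reach.exists_reachesP {G : PreGraph L} {u v : ℕ} (h : Reach G u v) :
    ∃ p, ReachesP G u p v := by
  induction h using Relation.ReflTransGen.head_induction_on with
  | refl => exact ⟨[], ReachesP.nil _⟩
  | head hab _ ih =>
    obtain ⟨p, hp⟩ := ih
    obtain ⟨i, hi⟩ := List.mem_iff_getElem?.mp hab.2
    exact ⟨i :: p, ReachesP.cons hab.1 hi hp⟩

theorem ReachesP.unique {G : PreGraph L} {u v w : ℕ} {p : List ℕ} (hv : ReachesP G u p v)
    (hw : ReachesP G u p w) : v = w := by
  induction hv with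
  | nil u => cases hw; rfl
  | cons _ hi _ ih =>
    cases hw with
    | cons _ hj hw =>
      rw [hi] at hj
      cases hj
      exact ih hw

theorem IsGeMorph.reachesP {S T : PreGraph (F ⊕ V)} {m : ℕ → ℕ} (hm : IsGeMorph S T m)
    {u w : ℕ} {p : List ℕ} (h : ReachesP S u p w) : ReachesP T (m u) p (m w) := by
  induction h with
  | nil u => exact ReachesP.nil _
  | cons hu hi _ ih =>
    exact ReachesP.cons (hm.maps _ hu) (by rw [hm.suc _ hu, List.getElem?_map, hi]; rfl) ih

theorem IsGeMorph.isPos {S T : PreGraph (F ⊕ V)} {m : ℕ → ℕ} (hm : IsGeMorph S T m)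
    {w : ℕ} {p : List ℕ} (h : IsPos S w p) : IsPos T (m w) p := by
  have := hm.reachesP h
  rwa [hm.root] at this

/-- Morphisms defined on all labels are surjective on the nodes of a term graph. -/
theorem IsGeMorph.nodes_eq_image {ar : F → ℕ} {S T : PreGraph (F ⊕ V)} {m : ℕ → ℕ}
    (hm : IsGeMorph S T m) (hS : IsTermGraph ar S) (hT : IsTermGraph ar T) :
    T.nodes = S.nodes.image m := by
  ext x
  simp only [Finset.mem_image]
  constructor
  · intro hx
    have h := hT.rootReach x hx
    clear hx
    induction h with
    | refl => exact ⟨S.root, hS.rootMem, hm.root⟩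
    | tail _ hbc ih =>
      obtain ⟨w, hw, rfl⟩ := ih
      have hc := hbc.2
      rw [hm.suc w hw, List.mem_map] at hc
      obtain ⟨w', hw', rfl⟩ := hc
      exact ⟨w', hS.closed w hw w' hw', rfl⟩
  · rintro ⟨w, hw, rfl⟩
    exact hm.maps w hw

/-- A single-step folding removes exactly the node `u`. -/
theorem CollapseS.nodes_eq_erase {ar : F → ℕ} {S T : PreGraph (F ⊕ V)} {u v : ℕ}
    (h : CollapseS S T u v) (hS : IsTermGraph ar S) (hT : IsTermGraph ar T) :
    T.nodes = S.nodes.erase u := by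
  obtain ⟨⟨_, hv, _, hm⟩, huv⟩ := h
  rw [hm.nodes_eq_image hS hT]
  ext x
  simp only [Finset.mem_image, Finset.mem_erase]
  constructor
  · rintro ⟨w, hw, rfl⟩
    split_ifs with hwu
    · exact ⟨huv.symm, hv⟩
    · exact ⟨hwu, hw⟩
  · rintro ⟨hxu, hx⟩
    exact ⟨x, hx, if_neg hxu⟩

/-- The position `q` belongs to a shared node of `G`. -/
def SharedPos (G : PreGraph L) (q : List ℕ) : Prop :=
  ∃ w q', q' ≠ q ∧ IsPos G w q ∧ IsPos G w q'

theorem IsTermGraph.eq_nil_of_reachesP_self {ar : F → ℕ} {G : PreGraph (F ⊕ V)}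
    (hG : IsTermGraph ar G) {u : ℕ} {q : List ℕ} (h : ReachesP G u q u) : q = [] := by
  cases h with
  | nil => rfl
  | cons hu hi hp =>
    exact (hG.acyclic _ _
      (Relation.TransGen.head' ⟨hu, List.mem_of_getElem? hi⟩ hp.reach) rfl).elim

theorem IsTermGraph.not_sharedPos_nil {ar : F → ℕ} {G : PreGraph (F ⊕ V)}
    (hG : IsTermGraph ar G) : ¬ SharedPos G [] := by
  rintro ⟨w, q', hq', hw, hw'⟩
  cases hw
  exact hq' (hG.eq_nil_of_reachesP_self hw')

open Classical in
/-- The lengths of the nonempty prefixes of `p` that are positions of shared nodes of `G`. -/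
noncomputable def sharedPrefixes (p : List ℕ) (G : PreGraph L) : Finset ℕ :=
  (Finset.Icc 1 p.length).filter fun k => SharedPos G (p.take k)

theorem card_sharedPrefixes_le (p : List ℕ) (G : PreGraph L) :
    (sharedPrefixes p G).card ≤ p.length := by
  classical
  simpa [sharedPrefixes] using Finset.card_filter_le (Finset.Icc 1 p.length) _

/-- Unfolding above `p` strictly decreases the set of shared prefixes of `p`. -/
theorem UnfoldAboveTG.sharedPrefixes_ssubset {ar : F → ℕ} {p : List ℕ} {S T : PreGraph (F ⊕ V)}
    (h : UnfoldAboveTG ar p S T) : sharedPrefixes p T ⊂ sharedPrefixes p S := by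
  classical
  obtain ⟨hS, hT, u, v, ⟨⟨hu, hv, _, hm⟩, huv⟩, q, hqp, hq⟩ := h
  have huq : IsPos T u q := (hq q).2 rfl
  have hqS : SharedPos S q := by
    obtain ⟨q', hvq'⟩ := (hT.rootReach v hv).exists_reachesP
    have h₁ := hm.isPos huq
    have h₂ := hm.isPos hvq'
    rw [if_pos rfl] at h₁
    rw [if_neg huv.symm] at h₂
    refine ⟨v, q', ?_, h₁, h₂⟩
    rintro rfl
    exact huv (huq.unique hvq')
  have hqT : ¬ SharedPos T q := by
    rintro ⟨w, q', hne, hw, hw'⟩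
    obtain rfl := huq.unique hw
    exact hne ((hq q').1 hw')
  have htake : p.take q.length = q := (List.prefix_iff_eq_take.mp hqp).symm
  have hpos : 1 ≤ q.length := by
    rw [Nat.one_le_iff_ne_zero, Ne, List.length_eq_zero_iff]
    rintro rfl
    exact hS.not_sharedPos_nil hqS
  refine (Finset.ssubset_iff_of_subset ?_).2 ⟨q.length, ?_, ?_⟩
  · refine Finset.monotone_filter_right _ fun k _ => ?_
    rintro ⟨w, q', hne, hw, hw'⟩
    exact ⟨_, q', hne, hm.isPos hw, hm.isPos hw'⟩
  · simp only [sharedPrefixes, Finset.mem_filter, Finset.mem_Icc, htake]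
    exact ⟨⟨hpos, hqp.length_le⟩, hqS⟩
  · simp only [sharedPrefixes, Finset.mem_filter, htake]
    exact fun h => hqT h.2

theorem UnfoldAboveTG.card_nodes {ar : F → ℕ} {p : List ℕ} {S T : PreGraph (F ⊕ V)}
    (h : UnfoldAboveTG ar p S T) : T.nodes.card = S.nodes.card + 1 := by
  obtain ⟨hS, hT, u, v, hc, _⟩ := h
  rw [hc.nodes_eq_erase hT hS, Finset.card_erase_add_one hc.1.1]

theorem iter_unfoldAboveTG_card {ar : F → ℕ} {p : List ℕ} {ℓ : ℕ} {S T : PreGraph (F ⊕ V)}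
    (h : Iter (UnfoldAboveTG ar p) ℓ S T) :
    ℓ ≤ (sharedPrefixes p S).card ∧ T.nodes.card = S.nodes.card + ℓ := by
  induction ℓ generalizing S with
  | zero =>
    obtain rfl : S = T := h
    simp
  | succ n ih =>
    obtain ⟨U, hSU, hUT⟩ := h
    obtain ⟨h₁, h₂⟩ := ih hUT
    have h₃ := Finset.card_lt_card hSU.sharedPrefixes_ssubset
    have h₄ := hSU.card_nodes
    omega

/-- If `S ▷_p^ℓ T` then `ℓ ≤ |p|` and `|T| ≤ |S| + |p|`. -/
theorem unfold_iter_bound {F V : Type} (ar : F → ℕ)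
    (S T : PreGraph (F ⊕ V)) (hS : IsTermGraph ar S)
    (p : List ℕ) (hp : ∃ w, IsPos S w p)
    (ℓ : ℕ) (h : Iter (UnfoldAboveTG ar p) ℓ S T) :
    ℓ ≤ p.length ∧ T.nodes.card ≤ S.nodes.card + p.length := by
  have h₁ := iter_unfoldAboveTG_card h
  have h₂ := card_sharedPrefixes_le p S
  omega

end TermGraphs
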